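/- arXiv:1804.10532 — 2 statements merged into one kernel-verified Lean document; each statement's English description precedes it below -/
import Mathlib

section
/- Let t > 1 and n = 2t be integers, and let k ≥ 1. Then every ideal ⟨x_{i_1}, x_{i_2}⟩ with 1 ≤ i_1 < i_2 ≤ 2t, i_1 odd and i_2 even, is an associated prime ideal of I^k, i.e., {⟨x_{i_1}, x_{i_2}⟩ : i_1 < i_2, i_1 odd, i_2 even} ⊆ Ass(I^k). -/
open MvPolynomial

/-- `F` is an independent set of the path graph `Pₙ` on vertices `x_1, …, x_n`
(encoded as `Fin n`, where `v : Fin n` corresponds to the vertex `x_{v+1}`):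
no two consecutive vertices belong to `F`. -/
def IsIndepSet (n : ℕ) (F : Finset (Fin n)) : Prop :=
  ∀ i ∈ F, ∀ j ∈ F, (i : ℕ) + 1 ≠ (j : ℕ)

/-- The ideal `Ind_t(Pₙ)` of `K[x_1, …, x_n]`, generated by all squarefree monomials
`x^F` where `F` is an independent set of the path graph `Pₙ` of size `t`. -/
noncomputable def indIdeal (K : Type*) [Field K] (n t : ℕ) :
    Ideal (MvPolynomial (Fin n) K) :=
  Ideal.span {m | ∃ F : Finset (Fin n), IsIndepSet n F ∧ F.card = t ∧ m = ∏ v ∈ F, X v}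

/-- An ideal generated by a set of variables is prime. -/
theorem MvPolynomial.isPrime_span_X_image {σ R : Type*} [CommRing R] [IsDomain R] (s : Set σ) :
    (Ideal.span (X '' s : Set (MvPolynomial σ R))).IsPrime := by
  classical
  set P : Ideal (MvPolynomial σ R) := Ideal.span (X '' s) with hP
  let φ : MvPolynomial σ R →ₐ[R] MvPolynomial σ R := aeval fun i => if i ∈ s then 0 else X i
  have hX : ∀ i ∈ s, (X i : MvPolynomial σ R) ∈ P := fun i hi =>
    Ideal.subset_span (Set.mem_image_of_mem _ hi)
  have hcomp : (Ideal.Quotient.mkₐ R P).comp φ = Ideal.Quotient.mkₐ R P := by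
    ext i
    by_cases hi : i ∈ s
    · have h := Ideal.Quotient.eq_zero_iff_mem.mpr (hX i hi)
      simp [φ, hi, h]
    · simp [φ, hi]
  have hker : RingHom.ker φ = P := by
    apply le_antisymm
    · intro f hf
      have h := DFunLike.congr_fun hcomp f
      rw [AlgHom.comp_apply, (RingHom.mem_ker).mp hf, map_zero] at h
      exact Ideal.Quotient.eq_zero_iff_mem.mp h.symm
    · rw [hP, Ideal.span_le]
      rintro _ ⟨i, hi, rfl⟩
      simp [φ, hi, RingHom.mem_ker]
  rw [← hker]
  exact RingHom.ker_isPrime _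

/-- An ideal generated by variables contains no further variable. -/
theorem MvPolynomial.X_mem_span_X_image_iff {σ R : Type*} [CommRing R] [Nontrivial R]
    {s : Set σ} {i : σ} : (X i : MvPolynomial σ R) ∈ Ideal.span (X '' s) ↔ i ∈ s := by
  classical
  refine ⟨fun h => ?_, fun h => Ideal.subset_span (Set.mem_image_of_mem _ h)⟩
  rw [mem_ideal_span_X_image] at h
  obtain ⟨j, hj, hne⟩ := h (Finsupp.single i 1) (by simp [support_X])
  have : i = j := by
    by_contra hij
    exact hne (by simp [hij])
  exact this ▸ hj

/-- An independent set of size `t` in the path on `2t` vertices meets each of the `t` edges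
`{2m, 2m + 1}`. -/
theorem IsIndepSet.exists_mem_div_two {t : ℕ} {F : Finset (Fin (2 * t))}
    (hF : IsIndepSet (2 * t) F) (hcard : F.card = t) {m : ℕ} (hm : m < t) :
    ∃ v ∈ F, (v : ℕ) / 2 = m := by
  have hsurj : Set.SurjOn (fun v : Fin (2 * t) => (v : ℕ) / 2) F (Finset.range t) := by
    apply Finset.surjOn_of_injOn_of_card_le
    · intro v _
      have := v.isLt
      simp only [Finset.coe_range, Set.mem_Iio]
      omega
    · intro v hv w hw h
      have h₁ := hF v hv w hw
      have h₂ := hF w hw v hv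
      simp only at h
      ext
      omega
    · simp [hcard]
  obtain ⟨v, hv, h⟩ := hsurj (by simpa using hm : m ∈ (Finset.range t : Set ℕ))
  exact ⟨v, hv, h⟩

/-- An independent set of size `t` in the path on `2t` vertices contains an even (0-based) vertex
`v₁` or any odd vertex `v₂ > v₁`. -/
theorem IsIndepSet.mem_or_mem {t : ℕ} {F : Finset (Fin (2 * t))}
    (hF : IsIndepSet (2 * t) F) (hcard : F.card = t) {v₁ v₂ : Fin (2 * t)} (hlt : v₁ < v₂)
    (h₁ : Even (v₁ : ℕ)) (h₂ : Odd (v₂ : ℕ)) : v₁ ∈ F ∨ v₂ ∈ F := by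
  by_contra! hnot
  obtain ⟨hn₁, hn₂⟩ := hnot
  obtain ⟨i, hi⟩ := h₁
  obtain ⟨j, hj⟩ := h₂
  have hlt' : (v₁ : ℕ) < v₂ := hlt
  have hv₂ := v₂.isLt
  have key : ∀ d, i + d ≤ j → ∃ v ∈ F, (v : ℕ) = 2 * (i + d) + 1 := by
    intro d
    induction d with
    | zero =>
      intro _
      obtain ⟨v, hv, h⟩ := hF.exists_mem_div_two hcard (m := i) (by omega)
      have : (v : ℕ) ≠ v₁ := fun h => hn₁ (Fin.ext h ▸ hv)
      exact ⟨v, hv, by omega⟩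
    | succ d ih =>
      intro hd
      obtain ⟨w, hw, hw'⟩ := ih (by omega)
      obtain ⟨v, hv, h⟩ := hF.exists_mem_div_two hcard (m := i + (d + 1)) (by omega)
      have := hF w hw v hv
      exact ⟨v, hv, by omega⟩
  obtain ⟨v, hv, h⟩ := key (j - i) (by omega)
  have : v = v₂ := Fin.ext (by omega)
  exact hn₂ (this ▸ hv)

/-- A prime containing `Ind_t` of the path on `2t` vertices contains a variable of each parity. -/
theorem exists_X_mem_of_indIdeal_le {K : Type*} [Field K] {t : ℕ}
    {Q : Ideal (MvPolynomial (Fin (2 * t)) K)} [Q.IsPrime] (hQ : indIdeal K (2 * t) t ≤ Q)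
    {r : ℕ} (hr : r < 2) : ∃ v : Fin (2 * t), (v : ℕ) % 2 = r ∧ X v ∈ Q := by
  classical
  let f : Fin t → Fin (2 * t) := fun j => ⟨2 * j + r, by omega⟩
  have hf : Function.Injective f := by
    intro a b h
    simp only [f, Fin.mk.injEq] at h
    ext
    omega
  have hmem : ∏ v ∈ Finset.univ.image f, (X v : MvPolynomial (Fin (2 * t)) K) ∈ Q := by
    refine hQ (Ideal.subset_span ⟨_, ?_, ?_, rfl⟩)
    · simp only [IsIndepSet, Finset.mem_image, Finset.mem_univ, true_and]
      rintro _ ⟨a, rfl⟩ _ ⟨b, rfl⟩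
      simp only [f]
      omega
    · simp [Finset.card_image_of_injective _ hf]
  obtain ⟨v, hv, hvQ⟩ := Ideal.IsPrime.prod_mem_iff.mp hmem
  obtain ⟨a, -, rfl⟩ := Finset.mem_image.mp hv
  exact ⟨_, by simp only [f]; omega, hvQ⟩

/-- If `n = 2t` then for every `k ≥ 1`, every ideal `⟨x_{i₁}, x_{i₂}⟩` with
`i₁ < i₂`, `i₁` odd and `i₂` even is an associated prime of `Iᵏ`.
In 0-based indexing `v = i - 1`, "`i₁` odd" becomes `Even (v₁ : ℕ)` and
"`i₂` even" becomes `Odd (v₂ : ℕ)`. -/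
theorem stmt3 (K : Type*) [Field K] (t n k : ℕ) (ht : 1 < t) (hn : n = 2 * t)
    (hk : 1 ≤ k) :
    {P : Ideal (MvPolynomial (Fin n) K) |
        ∃ v₁ v₂ : Fin n, v₁ < v₂ ∧ Even (v₁ : ℕ) ∧ Odd (v₂ : ℕ) ∧
          P = Ideal.span {X v₁, X v₂}} ⊆
      associatedPrimes (MvPolynomial (Fin n) K)
        (MvPolynomial (Fin n) K ⧸ (indIdeal K n t) ^ k) := by
  rintro P ⟨v₁, v₂, hlt, h₁, h₂, rfl⟩
  subst hn
  apply Module.associatedPrimes.minimalPrimes_annihilator_subset_associatedPrimes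
  have hX : ({X v₁, X v₂} : Set (MvPolynomial (Fin (2 * t)) K)) = X '' {v₁, v₂} := by
    rw [Set.image_pair]
  rw [Ideal.annihilator_quotient, hX]
  refine ⟨⟨isPrime_span_X_image _, ?_⟩, ?_⟩
  · refine (Ideal.pow_le_self (by omega)).trans ?_
    rw [indIdeal, Ideal.span_le]
    rintro _ ⟨F, hF, hcard, rfl⟩
    rcases hF.mem_or_mem hcard hlt h₁ h₂ with h | h <;>
      exact Ideal.mem_of_dvd _ (Finset.dvd_prod_of_mem _ h) (X_mem_span_X_image_iff.mpr (by simp))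
  · rintro Q ⟨hQ, hIQ⟩ hQP
    have hI := Ideal.IsPrime.le_of_pow_le hIQ
    rw [Nat.even_iff] at h₁
    rw [Nat.odd_iff] at h₂
    obtain ⟨w₁, hw₁, hwQ₁⟩ := exists_X_mem_of_indIdeal_le hI (r := 0) (by omega)
    obtain ⟨w₂, hw₂, hwQ₂⟩ := exists_X_mem_of_indIdeal_le hI (r := 1) (by omega)
    have e₁ : w₁ = v₁ := by
      rcases X_mem_span_X_image_iff.mp (hQP hwQ₁) with rfl | rfl
      · rfl
      · omega
    have e₂ : w₂ = v₂ := by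
      rcases X_mem_span_X_image_iff.mp (hQP hwQ₂) with rfl | rfl
      · omega
      · rfl
    subst e₁ e₂
    rw [Ideal.span_le]
    rintro _ ⟨v, rfl | rfl, rfl⟩
    exacts [hwQ₁, hwQ₂]
end

section
/- Let t > 1 be an integer and suppose n = 2t - 1 or n = 2t. Then I is normally torsion-free, i.e., Ass(I^k) = Ass(I) for every integer k ≥ 1; in particular the index of stability of I equals 1 and the stable set of associated primes of I equals Ass(I). -/
open MvPolynomial

section SquarefreeMonomialIdeals

variable {σ K : Type*} [Field K]

open Classical in
/-- The algebra map `x_v ↦ x_v z` for `v ∈ T` and `x_v ↦ x_v` otherwise, which records the degree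
in the variables of `T` as the exponent of a new variable `z`. -/
noncomputable def gradeHom (K : Type*) [Field K] (T : Finset σ) :
    MvPolynomial σ K →ₐ[K] Polynomial (MvPolynomial σ K) :=
  aeval fun v => Polynomial.C (X v) * if v ∈ T then Polynomial.X else 1

open Classical in
lemma gradeHom_monomial (T : Finset σ) (d : σ →₀ ℕ) (c : K) :
    gradeHom K T (monomial d c) = Polynomial.monomial (∑ v ∈ T, d v) (monomial d c) := by
  have hT : (d.prod fun v e => (if v ∈ T then (Polynomial.X : Polynomial (MvPolynomial σ K))
      else 1) ^ e) = Polynomial.X ^ ∑ v ∈ T, d v := by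
    rw [Finsupp.prod, ← Finset.prod_pow_eq_pow_sum, ← Finset.prod_subset
      (Finset.inter_subset_left : T ∩ d.support ⊆ T), Finset.inter_comm,
      ← Finset.filter_mem_eq_inter, Finset.prod_filter]
    · refine Finset.prod_congr rfl fun v _ => ?_
      split_ifs <;> simp
    · intro v hv hv'
      have : d v = 0 := by simpa [hv] using hv'
      simp [this]
  have hC : algebraMap K (Polynomial (MvPolynomial σ K)) c *
      (d.prod fun v e => (Polynomial.C (X v : MvPolynomial σ K)) ^ e) =
        Polynomial.C (monomial d c) := by
    rw [monomial_eq, map_mul, Finsupp.prod, Finsupp.prod, map_prod]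
    simp only [map_pow]
    rfl
  rw [gradeHom, aeval_monomial]
  simp only [mul_pow]
  rw [Finsupp.prod_mul, hT, ← mul_assoc, hC, Polynomial.C_mul_X_pow_eq_monomial]

open Classical in
lemma coeff_coeff_gradeHom (T : Finset σ) (f : MvPolynomial σ K) (d : σ →₀ ℕ) (k : ℕ) :
    coeff d ((gradeHom K T f).coeff k) = if ∑ v ∈ T, d v = k then coeff d f else 0 := by
  induction f using MvPolynomial.induction_on' with
  | monomial e c =>
    rw [gradeHom_monomial, Polynomial.coeff_monomial, coeff_monomial]
    by_cases hed : e = d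
    · subst hed
      rw [if_pos rfl]
      split_ifs <;> simp
    · split_ifs <;> simp [coeff_monomial, hed]
  | add p q hp hq =>
    rw [map_add, Polynomial.coeff_add, coeff_add, hp, hq, coeff_add]
    split_ifs <;> simp

/-- The ideal of polynomials all of whose monomials have degree at least `m` in the variables
of `T`. -/
noncomputable def gradeIdeal (K : Type*) [Field K] (T : Finset σ) (m : ℕ) :
    Ideal (MvPolynomial σ K) :=
  (Ideal.span {(Polynomial.X : Polynomial (MvPolynomial σ K)) ^ m}).comap (gradeHom K T)

lemma mem_gradeIdeal_iff_dvd {T : Finset σ} {m : ℕ} {f : MvPolynomial σ K} :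
    f ∈ gradeIdeal K T m ↔ Polynomial.X ^ m ∣ gradeHom K T f := by
  rw [gradeIdeal, Ideal.mem_comap, Ideal.mem_span_singleton]

lemma mem_gradeIdeal {T : Finset σ} {m : ℕ} {f : MvPolynomial σ K} :
    f ∈ gradeIdeal K T m ↔ ∀ d, coeff d f ≠ 0 → m ≤ ∑ v ∈ T, d v := by
  classical
  rw [mem_gradeIdeal_iff_dvd, Polynomial.X_pow_dvd_iff]
  refine ⟨fun h d hd => ?_, fun h k hk => ?_⟩
  · by_contra! hlt
    have := coeff_coeff_gradeHom T f d (∑ v ∈ T, d v)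
    rw [h _ hlt, if_pos rfl, coeff_zero] at this
    exact hd this.symm
  · ext d
    rw [coeff_coeff_gradeHom, coeff_zero]
    split_ifs with hdk
    · by_contra hd
      exact absurd (h d hd) (by omega)
    · rfl

lemma gradeIdeal_one_isPrime (T : Finset σ) : (gradeIdeal K T 1).IsPrime := by
  have : (Ideal.span {(Polynomial.X : Polynomial (MvPolynomial σ K)) ^ 1}).IsPrime := by
    rw [pow_one, Ideal.span_singleton_prime Polynomial.X_ne_zero]
    exact Polynomial.prime_X
  exact Ideal.comap_isPrime _ _

lemma mem_gradeIdeal_of_mul_mem {T : Finset σ} {m : ℕ} {f g : MvPolynomial σ K}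
    (hfg : g * f ∈ gradeIdeal K T m) (hg : g ∉ gradeIdeal K T 1) : f ∈ gradeIdeal K T m := by
  rw [mem_gradeIdeal_iff_dvd] at *
  rw [map_mul] at hfg
  rw [pow_one] at hg
  exact Polynomial.prime_X.pow_dvd_of_dvd_mul_left m hg hfg

lemma pow_le_gradeIdeal {T : Finset σ} {I : Ideal (MvPolynomial σ K)}
    (hI : I ≤ gradeIdeal K T 1) (m : ℕ) : I ^ m ≤ gradeIdeal K T m := by
  refine (Ideal.pow_right_mono hI m).trans ?_
  refine (Ideal.le_comap_pow _ m).trans ?_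
  rw [Ideal.span_singleton_pow, pow_one]
  exact le_rfl

lemma X_mem_gradeIdeal_one {T : Finset σ} {v : σ} :
    (X v : MvPolynomial σ K) ∈ gradeIdeal K T 1 ↔ v ∈ T := by
  classical
  rw [mem_gradeIdeal]
  simp only [coeff_X, ne_eq, ite_eq_right_iff, one_ne_zero, imp_false, not_not, forall_eq']
  rw [Finset.sum_congr rfl fun w _ => Finsupp.single_apply, Finset.sum_ite_eq]
  split_ifs with h <;> simp [h]

lemma gradeIdeal_one_le {T : Finset σ} {Q : Ideal (MvPolynomial σ K)}
    (hQ : ∀ v ∈ T, X v ∈ Q) : gradeIdeal K T 1 ≤ Q := by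
  intro f hf
  rw [f.as_sum]
  refine Q.sum_mem fun d hd => ?_
  have hpos := mem_gradeIdeal.1 hf d (mem_support_iff.1 hd)
  obtain ⟨v, hv, hdv⟩ : ∃ v ∈ T, d v ≠ 0 := by
    by_contra! h
    rw [Finset.sum_eq_zero h] at hpos
    omega
  exact Q.mem_of_dvd (X_dvd_monomial.2 (Or.inr hdv)) (hQ v hv)

/-- The ideal generated by the squarefree monomials supported on the members of `𝓕`. -/
noncomputable def squarefreeIdeal (K : Type*) [Field K] (𝓕 : Set (Finset σ)) :
    Ideal (MvPolynomial σ K) :=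
  Ideal.span {m | ∃ F ∈ 𝓕, m = ∏ v ∈ F, X v}

lemma monomial_mem_squarefreeIdeal_pow {𝓕 : Set (Finset σ)} {m : ℕ} {d : σ →₀ ℕ}
    {F : ℕ → Finset σ} (hF : ∀ s < m, F s ∈ 𝓕)
    [DecidableEq σ] (hd : ∀ v, ((Finset.range m).filter fun s => v ∈ F s).card ≤ d v) (c : K) :
    monomial d c ∈ squarefreeIdeal K 𝓕 ^ m := by
  have hprod : ∏ s ∈ Finset.range m, ∏ v ∈ F s, (X v : MvPolynomial σ K) ∈
      squarefreeIdeal K 𝓕 ^ m := by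
    have := Ideal.prod_mem_prod (s := Finset.range m) (I := fun _ => squarefreeIdeal K 𝓕)
      (x := fun s => ∏ v ∈ F s, (X v : MvPolynomial σ K))
      fun s hs => Ideal.subset_span ⟨F s, hF s (Finset.mem_range.1 hs), rfl⟩
    simpa using this
  refine Ideal.mem_of_dvd _ ?_ hprod
  have : ∏ s ∈ Finset.range m, ∏ v ∈ F s, (X v : MvPolynomial σ K) =
      monomial (∑ s ∈ Finset.range m, ∑ v ∈ F s, Finsupp.single v 1) 1 := by
    simp only [monomial_sum_one]
    rfl
  rw [this, monomial_dvd_monomial]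
  refine ⟨Or.inr fun v => ?_, one_dvd _⟩
  refine le_trans (le_of_eq ?_) (hd v)
  simp [Finsupp.finsetSum_apply, Finsupp.single_apply]

/-- If every `m` and every monomial of degree at least `m` along each `T ∈ S` is divisible by a
product of `m` generators, then all powers of the ideal have the same associated primes, provided
the primes generated by the members of `S` are minimal over the ideal. -/
theorem associatedPrimes_squarefreeIdeal_pow [Finite σ] [DecidableEq σ] {𝓕 S : Set (Finset σ)}
    (hcover : ∀ F ∈ 𝓕, ∀ T ∈ S, ∃ v ∈ F, v ∈ T)
    (hmin : ∀ T ∈ S, ∀ v ∈ T, ∃ F ∈ 𝓕, ∀ w ∈ F, w ∈ T → w = v)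
    (hpack : ∀ (m : ℕ) (d : σ →₀ ℕ), (∀ T ∈ S, m ≤ ∑ v ∈ T, d v) → ∃ F : ℕ → Finset σ,
      (∀ s < m, F s ∈ 𝓕) ∧ ∀ v, ((Finset.range m).filter fun s => v ∈ F s).card ≤ d v)
    {m : ℕ} (hm : m ≠ 0) :
    associatedPrimes (MvPolynomial σ K) (MvPolynomial σ K ⧸ squarefreeIdeal K 𝓕 ^ m) =
      (squarefreeIdeal K 𝓕).minimalPrimes := by
  have hle : ∀ T ∈ S, squarefreeIdeal K 𝓕 ≤ gradeIdeal K T 1 := by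
    intro T hT
    refine Ideal.span_le.2 ?_
    rintro _ ⟨F, hF, rfl⟩
    obtain ⟨v, hvF, hvT⟩ := hcover F hF T hT
    exact Ideal.mem_of_dvd _ (Finset.dvd_prod_of_mem _ hvF) (X_mem_gradeIdeal_one.2 hvT)
  have hminimal : ∀ T ∈ S, gradeIdeal K T 1 ∈ (squarefreeIdeal K 𝓕).minimalPrimes := by
    intro T hT
    refine ⟨⟨gradeIdeal_one_isPrime T, hle T hT⟩, ?_⟩
    rintro Q ⟨hQ, hIQ⟩ hQT
    refine gradeIdeal_one_le fun v hv => ?_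
    obtain ⟨F, hF, hFv⟩ := hmin T hT v hv
    have hFQ : ∏ w ∈ F, (X w : MvPolynomial σ K) ∈ Q := hIQ (Ideal.subset_span ⟨F, hF, rfl⟩)
    obtain ⟨w, hwF, hwQ⟩ := hQ.prod_mem_iff.1 hFQ
    rwa [← hFv w hwF (X_mem_gradeIdeal_one.1 (hQT hwQ))]
  have hmem : ∀ f : MvPolynomial σ K, (∀ T ∈ S, f ∈ gradeIdeal K T m) →
      f ∈ squarefreeIdeal K 𝓕 ^ m := by
    intro f hf
    rw [f.as_sum]
    refine Ideal.sum_mem _ fun d hd => ?_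
    obtain ⟨F, hF, hFd⟩ := hpack m d fun T hT =>
      mem_gradeIdeal.1 (hf T hT) d (mem_support_iff.1 hd)
    exact monomial_mem_squarefreeIdeal_pow hF hFd _
  have hpow : (squarefreeIdeal K 𝓕 ^ m).minimalPrimes = (squarefreeIdeal K 𝓕).minimalPrimes := by
    rw [← Ideal.radical_minimalPrimes, Ideal.radical_pow _ hm, Ideal.radical_minimalPrimes]
  have hsub : (squarefreeIdeal K 𝓕).minimalPrimes ⊆ associatedPrimes (MvPolynomial σ K)
      (MvPolynomial σ K ⧸ squarefreeIdeal K 𝓕 ^ m) := by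
    rw [← hpow]
    simpa [Ideal.annihilator_quotient] using
      Module.associatedPrimes.minimalPrimes_annihilator_subset_associatedPrimes
        (MvPolynomial σ K) (MvPolynomial σ K ⧸ squarefreeIdeal K 𝓕 ^ m)
  refine Set.Subset.antisymm (fun P hP => ?_) hsub
  obtain ⟨hPprime, x, hx⟩ := isAssociatedPrime_iff.1 (AssociatedPrimes.mem_iff.1 hP)
  obtain ⟨f, rfl⟩ := Ideal.Quotient.mk_surjective x
  have hPf : ∀ g, g ∈ P ↔ g * f ∈ squarefreeIdeal K 𝓕 ^ m := by
    intro g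
    rw [hx, Submodule.mem_colon_singleton, Submodule.mem_bot, ← Ideal.Quotient.eq_zero_iff_mem,
      map_mul]
    rfl
  have hf : f ∉ squarefreeIdeal K 𝓕 ^ m := by
    intro hf
    exact hPprime.ne_top ((Ideal.eq_top_iff_one P).2 ((hPf 1).2 (by simpa using hf)))
  obtain ⟨T, hT, hfT⟩ : ∃ T ∈ S, f ∉ gradeIdeal K T m := by
    by_contra! h
    exact hf (hmem f h)
  have hPT : P ≤ gradeIdeal K T 1 := by
    intro g hg
    by_contra hgT
    exact hfT (mem_gradeIdeal_of_mul_mem (pow_le_gradeIdeal (hle T hT) m ((hPf g).1 hg)) hgT)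
  have hIP : squarefreeIdeal K 𝓕 ≤ P := by
    rw [← hPprime.pow_le_iff hm]
    exact fun g hg => (hPf g).2 (Ideal.mul_mem_right _ _ hg)
  rw [le_antisymm hPT ((hminimal T hT).2 ⟨hPprime, hIP⟩ hPT)]
  exact hminimal T hT

end SquarefreeMonomialIdeals

section Path

variable {n t : ℕ} {F : Finset (Fin n)}

lemma IsIndepSet.injOn_div_two (hF : IsIndepSet n F) :
    Set.InjOn (fun v : Fin n => (v : ℕ) / 2) F := by
  intro v hv w hw hvw
  have h1 := hF v hv w hw
  have h2 := hF w hw v hv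
  simp only at hvw
  ext
  omega

lemma IsIndepSet.card_eq (hF : IsIndepSet n F) (hn : n ≤ 2 * t)
    (hex : ∀ i < t, ∃ v ∈ F, (v : ℕ) / 2 = i) : F.card = t := by
  rw [← Finset.card_image_of_injOn hF.injOn_div_two]
  have : F.image (fun v : Fin n => (v : ℕ) / 2) = Finset.range t := by
    ext i
    simp only [Finset.mem_image, Finset.mem_range]
    refine ⟨?_, hex i⟩
    rintro ⟨v, -, rfl⟩
    omega
  rw [this, Finset.card_range]

lemma IsIndepSet.exists_div_two_eq (hF : IsIndepSet n F) (hn : n ≤ 2 * t) (hcard : F.card = t)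
    {i : ℕ} (hi : i < t) : ∃ v ∈ F, (v : ℕ) / 2 = i := by
  have hsub : F.image (fun v : Fin n => (v : ℕ) / 2) ⊆ Finset.range t := by
    intro i
    simp only [Finset.mem_image, Finset.mem_range]
    rintro ⟨v, -, rfl⟩
    omega
  have heq := Finset.eq_of_subset_of_card_le hsub
    (by rw [Finset.card_image_of_injOn hF.injOn_div_two, hcard, Finset.card_range])
  rw [← Finset.mem_range, ← heq] at hi
  simpa using hi

lemma IsIndepSet.exists_odd_of_notMem (hF : IsIndepSet n F) (hn : n ≤ 2 * t) (hcard : F.card = t)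
    {u : Fin n} (hu : (u : ℕ) % 2 = 0) (huF : u ∉ F) {k : ℕ} (huk : (u : ℕ) / 2 ≤ k)
    (hk : k < t) : ∃ v ∈ F, (v : ℕ) = 2 * k + 1 := by
  induction k, huk using Nat.le_induction with
  | base =>
    obtain ⟨v, hv, hvu⟩ := hF.exists_div_two_eq hn hcard hk
    have : v ≠ u := fun h => huF (h ▸ hv)
    exact ⟨v, hv, by omega⟩
  | succ k huk ih =>
    obtain ⟨w, hw, hwk⟩ := ih (by omega)
    obtain ⟨v, hv, hvk⟩ := hF.exists_div_two_eq hn hcard hk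
    have := hF w hw v hv
    exact ⟨v, hv, by omega⟩

/-- The supports of the generators of `indIdeal K n t`. -/
def indepSets (n t : ℕ) : Set (Finset (Fin n)) :=
  {F | IsIndepSet n F ∧ F.card = t}

lemma indIdeal_eq_squarefreeIdeal (K : Type*) [Field K] (n t : ℕ) :
    indIdeal K n t = squarefreeIdeal K (indepSets n t) := by
  simp only [indIdeal, squarefreeIdeal, indepSets, Set.mem_ofPred_eq, and_assoc]

lemma even_mem_indepSets (hn : n = 2 * t - 1 ∨ n = 2 * t) :
    (Finset.univ.filter fun v : Fin n => (v : ℕ) % 2 = 0) ∈ indepSets n t := by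
  have hindep : IsIndepSet n (Finset.univ.filter fun v : Fin n => (v : ℕ) % 2 = 0) := by
    intro v hv w hw
    simp only [Finset.mem_filter, Finset.mem_univ, true_and] at hv hw
    omega
  refine ⟨hindep, hindep.card_eq (by omega) fun i hi => ⟨⟨2 * i, by omega⟩, ?_, ?_⟩⟩
  · simp
  · simp

lemma odd_mem_indepSets (hn : n = 2 * t) :
    (Finset.univ.filter fun v : Fin n => (v : ℕ) % 2 = 1) ∈ indepSets n t := by
  have hindep : IsIndepSet n (Finset.univ.filter fun v : Fin n => (v : ℕ) % 2 = 1) := by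
    intro v hv w hw
    simp only [Finset.mem_filter, Finset.mem_univ, true_and] at hv hw
    omega
  refine ⟨hindep, hindep.card_eq (by omega) fun i hi => ⟨⟨2 * i + 1, by omega⟩, ?_, ?_⟩⟩
  · simp
  · simp only; omega

open Classical in
/-- The vertices of even index up to which `d` exceeds `s` at all even indices, together with the
remaining vertices of odd index. -/
noncomputable def thresholdSet (d : Fin n → ℕ) (s : ℕ) : Finset (Fin n) :=
  Finset.univ.filter fun v =>
    ((v : ℕ) % 2 = 0 ↔ ∀ u : Fin n, (u : ℕ) % 2 = 0 → u ≤ v → s < d u)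

lemma mem_thresholdSet {d : Fin n → ℕ} {s : ℕ} {v : Fin n} :
    v ∈ thresholdSet d s ↔
      ((v : ℕ) % 2 = 0 ↔ ∀ u : Fin n, (u : ℕ) % 2 = 0 → u ≤ v → s < d u) := by
  simp [thresholdSet]

lemma thresholdSet_mem_indepSets (hn : n = 2 * t) (d : Fin n → ℕ) (s : ℕ) :
    thresholdSet d s ∈ indepSets n t := by
  have hindep : IsIndepSet n (thresholdSet d s) := by
    intro v hv w hw hvw
    rw [mem_thresholdSet] at hv hw
    rcases Nat.mod_two_eq_zero_or_one (v : ℕ) with h | h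
    · have hw' : ¬ (w : ℕ) % 2 = 0 := by omega
      refine hw' (hw.2 fun u hu huw => hv.1 h u hu ?_)
      rw [Fin.le_def] at huw ⊢
      omega
    · have hv' : ¬ (v : ℕ) % 2 = 0 := by omega
      refine hv' (hv.2 fun u hu huv => hw.1 (by omega) u hu ?_)
      rw [Fin.le_def] at huv ⊢
      omega
  refine ⟨hindep, hindep.card_eq hn.le fun i hi => ?_⟩
  by_cases h : ∀ u : Fin n, (u : ℕ) % 2 = 0 → u ≤ ⟨2 * i, by omega⟩ → s < d u
  · refine ⟨⟨2 * i, by omega⟩, mem_thresholdSet.2 (iff_of_true (by simp) h), by simp⟩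
  · refine ⟨⟨2 * i + 1, by omega⟩, mem_thresholdSet.2 (iff_of_false (by simp only; omega) ?_),
      by simp only; omega⟩
    refine fun h' => h fun u hu hui => h' u hu ?_
    rw [Fin.le_def] at hui ⊢
    simp only at hui ⊢
    omega

lemma card_filter_mem_thresholdSet_le {d : Fin n → ℕ} {m : ℕ}
    (hd : ∀ u v : Fin n, (u : ℕ) % 2 = 0 → (v : ℕ) % 2 = 1 → u < v → m ≤ d u + d v) (v : Fin n) :
    ((Finset.range m).filter fun s => v ∈ thresholdSet d s).card ≤ d v := by
  rcases Nat.mod_two_eq_zero_or_one (v : ℕ) with h | h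
  · rw [← Finset.card_range (d v)]
    refine Finset.card_le_card fun s hs => ?_
    rw [Finset.mem_filter, mem_thresholdSet] at hs
    exact Finset.mem_range.2 (hs.2.1 h v h le_rfl)
  · have hsub : ((Finset.range m).filter fun s => v ∈ thresholdSet d s) ⊆
        Finset.Ico (m - d v) m := by
      intro s hs
      rw [Finset.mem_filter, mem_thresholdSet, Finset.mem_range] at hs
      have hnot : ¬ ∀ u : Fin n, (u : ℕ) % 2 = 0 → u ≤ v → s < d u := fun h' => by
        have := hs.2.2 h'
        omega
      push Not at hnot
      obtain ⟨u, hu, huv, hus⟩ := hnot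
      have hne : u ≠ v := by rintro rfl; omega
      have := hd u v hu h (lt_of_le_of_ne huv hne)
      rw [Finset.mem_Ico]
      omega
    refine (Finset.card_le_card hsub).trans ?_
    rw [Nat.card_Ico]
    omega

variable (K : Type*) [Field K]

theorem associatedPrimes_indIdeal_pow_of_eq_two_mul (hn : n = 2 * t) {m : ℕ} (hm : m ≠ 0) :
    associatedPrimes (MvPolynomial (Fin n) K) (MvPolynomial (Fin n) K ⧸ indIdeal K n t ^ m) =
      (indIdeal K n t).minimalPrimes := by
  rw [indIdeal_eq_squarefreeIdeal]
  refine associatedPrimes_squarefreeIdeal_pow (S := {T | ∃ u v : Fin n, (u : ℕ) % 2 = 0 ∧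
    (v : ℕ) % 2 = 1 ∧ u < v ∧ T = {u, v}}) ?_ ?_ ?_ hm
  · rintro F ⟨hF, hcard⟩ _ ⟨u, v, hu, hv, huv, rfl⟩
    by_cases huF : u ∈ F
    · exact ⟨u, huF, by simp⟩
    · rw [Fin.lt_def] at huv
      obtain ⟨w, hw, hwv⟩ := hF.exists_odd_of_notMem hn.le hcard hu huF
        (k := (v : ℕ) / 2) (by omega) (by omega)
      obtain rfl : w = v := by ext; omega
      exact ⟨w, hw, by simp⟩
  · rintro _ ⟨u, v, hu, hv, huv, rfl⟩ w hw
    rw [Finset.mem_insert, Finset.mem_singleton] at hw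
    rcases hw with rfl | rfl
    · refine ⟨_, even_mem_indepSets (Or.inr hn), fun x hx hxT => ?_⟩
      rw [Finset.mem_insert, Finset.mem_singleton] at hxT
      simp only [Finset.mem_filter, Finset.mem_univ, true_and] at hx
      rcases hxT with rfl | rfl
      · rfl
      · omega
    · refine ⟨_, odd_mem_indepSets hn, fun x hx hxT => ?_⟩
      rw [Finset.mem_insert, Finset.mem_singleton] at hxT
      simp only [Finset.mem_filter, Finset.mem_univ, true_and] at hx
      rcases hxT with rfl | rfl
      · omega
      · rfl
  · intro m d hd
    refine ⟨thresholdSet d, fun s _ => thresholdSet_mem_indepSets hn d s,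
      card_filter_mem_thresholdSet_le fun u v hu hv huv => ?_⟩
    have := hd {u, v} ⟨u, v, hu, hv, huv, rfl⟩
    rwa [Finset.sum_pair huv.ne] at this

theorem associatedPrimes_indIdeal_pow_of_eq_two_mul_sub_one (hn : n = 2 * t - 1) {m : ℕ}
    (hm : m ≠ 0) :
    associatedPrimes (MvPolynomial (Fin n) K) (MvPolynomial (Fin n) K ⧸ indIdeal K n t ^ m) =
      (indIdeal K n t).minimalPrimes := by
  rw [indIdeal_eq_squarefreeIdeal]
  refine associatedPrimes_squarefreeIdeal_pow (S := {T | ∃ u : Fin n, (u : ℕ) % 2 = 0 ∧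
    T = {u}}) ?_ ?_ ?_ hm
  · rintro F ⟨hF, hcard⟩ _ ⟨u, hu, rfl⟩
    refine ⟨u, ?_, by simp⟩
    by_contra huF
    obtain ⟨w, -, hw⟩ := hF.exists_odd_of_notMem (by omega) hcard hu huF
      (k := t - 1) (by omega) (by omega)
    omega
  · rintro _ ⟨u, hu, rfl⟩ w hw
    rw [Finset.mem_singleton] at hw
    subst hw
    exact ⟨_, even_mem_indepSets (Or.inl hn), fun x _ hxT => Finset.mem_singleton.1 hxT⟩
  · intro m d hd
    refine ⟨fun _ => Finset.univ.filter fun v : Fin n => (v : ℕ) % 2 = 0,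
      fun s _ => even_mem_indepSets (Or.inl hn), fun v => ?_⟩
    by_cases hv : (v : ℕ) % 2 = 0
    · simpa [hv] using hd {v} ⟨v, hv, rfl⟩
    · simp [hv]

end Path

/-- If `t > 1` and `n = 2t - 1` or `n = 2t`, then `I = Ind_t(Pₙ)` is normally
torsion-free: `Ass(Iᵏ) = Ass(I)` for every `k ≥ 1` (hence the index of stability
of `I` is `1` and the stable set of associated primes equals `Ass(I)`). -/
theorem stmt10 (K : Type*) [Field K] (t n : ℕ) (ht : 1 < t)
    (hn : n = 2 * t - 1 ∨ n = 2 * t) :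
    ∀ k : ℕ, 1 ≤ k →
      associatedPrimes (MvPolynomial (Fin n) K)
          (MvPolynomial (Fin n) K ⧸ (indIdeal K n t) ^ k) =
        associatedPrimes (MvPolynomial (Fin n) K)
          (MvPolynomial (Fin n) K ⧸ indIdeal K n t) := by
  have key : ∀ m : ℕ, m ≠ 0 → associatedPrimes (MvPolynomial (Fin n) K)
      (MvPolynomial (Fin n) K ⧸ indIdeal K n t ^ m) = (indIdeal K n t).minimalPrimes := by
    intro m hm
    rcases hn with hn | hn
    · exact associatedPrimes_indIdeal_pow_of_eq_two_mul_sub_one K hn hm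
    · exact associatedPrimes_indIdeal_pow_of_eq_two_mul K hn hm
  intro k hk
  have hone := key 1 one_ne_zero
  rw [pow_one] at hone
  rw [key k (by omega), hone]
end
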